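/- Let G be a finite group, X a based G-space with nondegenerate basepoint, and V a finite-dimensional real representation of G with no trivial summand (V^G = 0). Let Z ⊂ Ω^V S^V(X) be the subspace of based equivariant maps S^V → S^V ∧ X which send a neighbourhood of 0 and a neighbourhood of ∞ to the basepoint. Then the map u : Ω^V S^V(X) → X^G × Z (recording the G-fixed label determined by the value at 0 and, after squeezing near 0 and ∞, the residual map on the complement of a small disc about 0) and the map v : X^G × Z → Ω^V S^V(X) sending (p, g) to the map which identifies D/∂D with S^V ∧ {p} on a small disc D centred at 0 and equals g on V − D are mutually inverse homotopy equivalences. -/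

import Mathlib

/-!
Rourke–Sanderson, "Equivariant configuration spaces", section 4: for a representation
`V` of a finite group `G` with no trivial summand and a based `G`-space `X`, let
`Z ⊂ Ω^V S^V(X)` be the subspace of maps killing a neighbourhood of `0` and a
neighbourhood of `∞`.  Then the map `u : Ω^V S^V(X) → X^G × Z` (recording the `G`-fixed
label determined by the value at `0`, and the residual map off a small disc about `0`)
and the map `v : X^G × Z → Ω^V S^V(X)` sending `(p, g)` to the map identifying `D/∂D`
with `S^V ∧ {p}` on the unit disc `D` about `0` and given by `g` on `V − D`, are
mutually inverse homotopy equivalences.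
-/

open Classical Topology unitInterval OnePoint

noncomputable section

/-- The relation collapsing `X ∨ Y` inside `X × Y`. -/
def SmashRel (X Y : Type) (x₀ : X) (y₀ : Y) : X × Y → X × Y → Prop := fun p q =>
  p = q ∨ ((p.1 = x₀ ∨ p.2 = y₀) ∧ (q.1 = x₀ ∨ q.2 = y₀))

/-- The smash product `X ∧ Y` of based spaces, with the quotient topology. -/
def Smash (X Y : Type) [TopologicalSpace X] [TopologicalSpace Y] (x₀ : X) (y₀ : Y) : Type :=
  Quot (SmashRel X Y x₀ y₀)

instance (X Y : Type) [TopologicalSpace X] [TopologicalSpace Y] (x₀ : X) (y₀ : Y) :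
    TopologicalSpace (Smash X Y x₀ y₀) := by unfold Smash; infer_instance

/-- The class of a point in the smash product. -/
def Smash.mk {X Y : Type} [TopologicalSpace X] [TopologicalSpace Y] {x₀ : X} {y₀ : Y}
    (x : X) (y : Y) : Smash X Y x₀ y₀ := Quot.mk _ (x, y)

/-- The basepoint of the smash product. -/
def Smash.pt {X Y : Type} [TopologicalSpace X] [TopologicalSpace Y] (x₀ : X) (y₀ : Y) :
    Smash X Y x₀ y₀ := Quot.mk _ (x₀, y₀)

variable (G : Type) [Group G]
variable (V : Type) [NormedAddCommGroup V] [NormedSpace ℝ V] [MulAction G V]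
variable (X : Type) [TopologicalSpace X] [MulAction G X] (x₀ : X)

/-- The action of `G` on the one-point compactification `S^V` of `V` (based at `∞`). -/
def sphereSMul (g : G) : OnePoint V → OnePoint V := OnePoint.map (fun v : V => g • v)

/-- `S^V(X) = S^V ∧ X`. -/
abbrev SphereSmash := Smash (OnePoint V) X ∞ x₀

/-- The basepoint of `S^V ∧ X`. -/
def SphereSmash.pt : SphereSmash V X x₀ := Smash.pt ∞ x₀

/-- The diagonal action of `G` on `S^V ∧ X`. -/
def sphereSmashSMul (hx : ∀ g : G, g • x₀ = x₀) (g : G) :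
    SphereSmash V X x₀ → SphereSmash V X x₀ :=
  Quot.map (fun p => (sphereSMul G V g p.1, g • p.2)) (by
    rintro p q (rfl | ⟨hp, hq⟩)
    · exact Or.inl rfl
    · refine Or.inr ⟨?_, ?_⟩
      · rcases hp with h | h
        · exact Or.inl (by simp only [h, sphereSMul]; rfl)
        · exact Or.inr (by show g • p.2 = x₀; rw [h, hx])
      · rcases hq with h | h
        · exact Or.inl (by simp only [h, sphereSMul]; rfl)
        · exact Or.inr (by show g • q.2 = x₀; rw [h, hx]))

/-- `Ω^V S^V(X)`: based `G`-equivariant maps `S^V → S^V ∧ X`, with the compact-open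
topology. -/
def OmegaV (hx : ∀ g : G, g • x₀ = x₀) : Type :=
  {φ : C(OnePoint V, SphereSmash V X x₀) //
    φ ∞ = SphereSmash.pt V X x₀ ∧
      ∀ (g : G) (w : OnePoint V),
        φ (sphereSMul G V g w) = sphereSmashSMul G V X x₀ hx g (φ w)}

instance (hx : ∀ g : G, g • x₀ = x₀) : TopologicalSpace (OmegaV G V X x₀ hx) := by
  unfold OmegaV; infer_instance

/-- The fixed point space `X^G`, based at the basepoint. -/
abbrev FixedPts : Type := {x : X // ∀ g : G, g • x = x}

/-- The subspace `Z ⊂ Ω^V S^V(X)` of maps sending a neighbourhood of `0` and a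
neighbourhood of `∞` to the basepoint. -/
def ZSpace (hx : ∀ g : G, g • x₀ = x₀) : Type :=
  {f : OmegaV G V X x₀ hx //
    (∃ U ∈ 𝓝 (((0 : V) : OnePoint V)), ∀ w ∈ U, f.1 w = SphereSmash.pt V X x₀) ∧
    (∃ U ∈ 𝓝 ((∞ : OnePoint V)), ∀ w ∈ U, f.1 w = SphereSmash.pt V X x₀)}

instance (hx : ∀ g : G, g • x₀ = x₀) : TopologicalSpace (ZSpace G V X x₀ hx) := by
  unfold ZSpace; infer_instance

/-- The underlying function of `v(p, g)`: identify `D/∂D` with `S^V ∧ {p}` on the unit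
disc `D` centred at `0` (by radial expansion), and map `V − D` by `g` (via the radial
identification of `V − D` with `V` sending `∂D` to `0`). -/
def vFun (hx : ∀ g : G, g • x₀ = x₀) (p : FixedPts G X) (f : ZSpace G V X x₀ hx) :
    OnePoint V → SphereSmash V X x₀ := fun w =>
  match w with
  | ∞ => SphereSmash.pt V X x₀
  | (v : V) =>
      if ‖v‖ < 1 then Smash.mk (((1 - ‖v‖)⁻¹ • v : V)) (p : X)
      else f.1.1 ((((‖v‖ - 1) / ‖v‖) • v : V))

section Sphere

variable {V : Type} [NormedAddCommGroup V] [NormedSpace ℝ V]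

/-- The map `V → S^V` identifying `D/∂D` with `S^V` on the unit disc `D` and collapsing
`V − D` to `∞`. -/
def discToSphere (v : V) : OnePoint V :=
  if ‖v‖ < 1 then (((1 - ‖v‖)⁻¹ • v : V) : OnePoint V) else ∞

/-- The composite of `discToSphere` with the inversion exchanging `0` and `∞`. -/
def discToSphereInv (v : V) : OnePoint V :=
  if v = 0 then ∞ else (((max 0 (1 - ‖v‖) / ‖v‖ ^ 2) • v : V) : OnePoint V)

theorem discToSphere_zero : discToSphere (0 : V) = ((0 : V) : OnePoint V) := by
  simp [discToSphere]

theorem discToSphere_of_one_le {v : V} (h : 1 ≤ ‖v‖) : discToSphere v = ∞ := by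
  simp [discToSphere, not_lt.2 h]

theorem discToSphere_of_lt_one {v : V} (h : ‖v‖ < 1) :
    discToSphere v = (((1 - ‖v‖)⁻¹ • v : V) : OnePoint V) := by
  simp [discToSphere, h]

theorem discToSphereInv_zero : discToSphereInv (0 : V) = ∞ := by
  simp [discToSphereInv]

theorem discToSphereInv_of_norm_eq_one {v : V} (h : ‖v‖ = 1) :
    discToSphereInv v = ((0 : V) : OnePoint V) := by
  have : v ≠ 0 := by rintro rfl; simp at h
  simp [discToSphereInv, this, h]

theorem discToSphereInv_smul {w : V} (hw : w ≠ 0) {s : ℝ} (h0 : 0 ≤ s) (h1 : s ≤ 1) :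
    discToSphereInv ((s / ‖w‖) • w) = discToSphere (((1 - s) / ‖w‖) • w) := by
  have hr : 0 < ‖w‖ := norm_pos_iff.2 hw
  have n1 : ‖(s / ‖w‖) • w‖ = s := by
    rw [norm_smul, Real.norm_of_nonneg (by positivity)]; field_simp
  have n2 : ‖((1 - s) / ‖w‖) • w‖ = 1 - s := by
    rw [norm_smul, Real.norm_of_nonneg (div_nonneg (by linarith) hr.le)]; field_simp
  rcases h0.eq_or_lt with rfl | h0
  · rw [zero_div, zero_smul, discToSphereInv_zero, discToSphere_of_one_le (by rw [n2]; simp)]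
  · rw [discToSphere_of_lt_one (by rw [n2]; linarith), discToSphereInv, n1, n2,
      if_neg (by rw [← norm_eq_zero, n1]; exact h0.ne'), max_eq_right (by linarith),
      smul_smul, smul_smul]
    congr 2
    rw [sub_sub_cancel]
    field_simp

theorem tendsto_nhds_infty_of_norm [FiniteDimensional ℝ V] {α : Type*} {l : Filter α}
    {F : α → OnePoint V}
    (h : ∀ R : ℝ, 0 ≤ R → ∀ᶠ x in l, ∀ v : V, F x = (v : OnePoint V) → R < ‖v‖) :
    Filter.Tendsto F l (𝓝 ∞) := by
  have : ProperSpace V := FiniteDimensional.proper ℝ V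
  intro U hU
  rw [OnePoint.nhds_infty_eq, Filter.mem_sup, Filter.mem_map,
    Filter.coclosedCompact_eq_cocompact, ← Metric.cobounded_eq_cocompact] at hU
  obtain ⟨hU, hi⟩ := hU
  obtain ⟨R, -, hR⟩ := (Metric.hasBasis_cobounded_compl_closedBall (0 : V)).mem_iff.1 hU
  rw [Filter.mem_map]
  filter_upwards [h (max R 0) (le_max_right _ _)] with x hx
  show F x ∈ U
  cases hF : F x using OnePoint.rec with
  | infty => exact hi
  | coe v =>
    refine hR ?_
    have := (le_max_left _ _).trans_lt (hx v hF)
    simpa using this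

theorem eventually_norm_gt_infty [FiniteDimensional ℝ V] (R : ℝ) :
    ∀ᶠ w in 𝓝 (∞ : OnePoint V), ∀ v : V, w = (v : OnePoint V) → R < ‖v‖ := by
  have : ProperSpace V := FiniteDimensional.proper ℝ V
  rw [OnePoint.nhds_infty_eq, Filter.eventually_sup, Filter.eventually_map,
    Filter.coclosedCompact_eq_cocompact, ← Metric.cobounded_eq_cocompact]
  refine ⟨?_, by simp⟩
  filter_upwards [(Metric.hasBasis_cobounded_compl_closedBall (0 : V)).mem_of_mem
    (i := R) trivial] with x hx v hv
  rw [← OnePoint.coe_injective hv]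
  simpa using hx

theorem continuous_discToSphere [FiniteDimensional ℝ V] :
    Continuous (discToSphere : V → OnePoint V) := by
  rw [continuous_iff_continuousAt]
  intro v
  rcases lt_or_ge ‖v‖ 1 with h | h
  · have : ContinuousAt (fun v : V => (((1 - ‖v‖)⁻¹ • v : V) : OnePoint V)) v := by
      refine OnePoint.continuous_coe.continuousAt.comp ?_
      exact ((continuousAt_const.sub continuous_norm.continuousAt).inv₀
        (sub_pos.2 h).ne').smul continuousAt_id
    refine this.congr ?_
    filter_upwards [continuous_norm.continuousAt.eventually_lt continuousAt_const h] with x hx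
    exact (discToSphere_of_lt_one hx).symm
  · rw [ContinuousAt, discToSphere_of_one_le h]
    refine tendsto_nhds_infty_of_norm fun R hR => ?_
    have : R / (R + 1) < ‖v‖ := lt_of_lt_of_le (by rw [div_lt_one (by linarith)]; linarith) h
    filter_upwards [continuousAt_const.eventually_lt continuous_norm.continuousAt this]
      with x hx u hu
    rw [discToSphere] at hu
    split_ifs at hu with h1
    · rw [← OnePoint.coe_injective hu, norm_smul, norm_inv, Real.norm_of_nonneg (by linarith),
        inv_mul_eq_div, lt_div_iff₀ (by linarith)]
      rw [div_lt_iff₀ (by linarith)] at hx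
      linarith
    · exact absurd hu (OnePoint.infty_ne_coe _)

theorem continuous_discToSphereInv [FiniteDimensional ℝ V] :
    Continuous (discToSphereInv : V → OnePoint V) := by
  rw [continuous_iff_continuousAt]
  intro v
  by_cases h : v = 0
  · subst h
    rw [ContinuousAt, discToSphereInv_zero]
    refine tendsto_nhds_infty_of_norm fun R hR => ?_
    have : ‖(0 : V)‖ < 1 / (R + 1) := by rw [norm_zero]; positivity
    filter_upwards [continuous_norm.continuousAt.eventually_lt continuousAt_const this]
      with x hx u hu
    rw [discToSphereInv] at hu
    split_ifs at hu with h1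
    · exact absurd hu (OnePoint.infty_ne_coe _)
    · have hx0 : 0 < ‖x‖ := norm_pos_iff.2 h1
      rw [lt_div_iff₀ (by linarith)] at hx
      have : ‖x‖ ≤ 1 := by nlinarith
      rw [← OnePoint.coe_injective hu, norm_smul, Real.norm_of_nonneg (by positivity),
        max_eq_right (by linarith)]
      have e : (1 - ‖x‖) / ‖x‖ ^ 2 * ‖x‖ = (1 - ‖x‖) / ‖x‖ := by field_simp
      rw [e, lt_div_iff₀ hx0]
      linarith
  · have : ContinuousAt
        (fun v : V => (((max 0 (1 - ‖v‖) / ‖v‖ ^ 2) • v : V) : OnePoint V)) v := by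
      refine OnePoint.continuous_coe.continuousAt.comp ?_
      refine ContinuousAt.smul (ContinuousAt.div ?_ ?_ ?_) continuousAt_id
      · fun_prop
      · fun_prop
      · simpa using h
    refine this.congr ?_
    filter_upwards [isOpen_ne.mem_nhds h] with x hx
    rw [discToSphereInv, if_neg hx]

/-- The extension of `discToSphere ∘ h` to `S^V` fixing `∞`. -/
def sphereExtend (h : V → V) (w : OnePoint V) : OnePoint V :=
  w.elim ∞ fun v => discToSphere (h v)

@[simp] theorem sphereExtend_infty (h : V → V) : sphereExtend h ∞ = ∞ := rfl

@[simp] theorem sphereExtend_coe (h : V → V) (v : V) :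
    sphereExtend h (v : OnePoint V) = discToSphere (h v) := rfl

theorem continuous_sphereExtend [FiniteDimensional ℝ V] {T : Type*} [TopologicalSpace T]
    {h : T → V → V} (hc : Continuous fun q : T × V => h q.1 q.2) {C : ℝ}
    (hg : ∀ t v, ‖v‖ ≤ C + ‖v‖ * ‖h t v‖) :
    Continuous fun q : T × OnePoint V => sphereExtend (h q.1) q.2 := by
  rw [continuous_iff_continuousAt]
  rintro ⟨t, w⟩
  cases w using OnePoint.rec with
  | infty =>
    rw [ContinuousAt, sphereExtend_infty]
    refine tendsto_nhds_infty_of_norm fun R hR => ?_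
    have := (continuous_snd (X := T)).continuousAt (x := (t, ∞)) |>.eventually
      (eventually_norm_gt_infty (V := V) ((R + 1) * C))
    filter_upwards [this] with ⟨t', w⟩ hw u hu
    cases w using OnePoint.rec with
    | infty => exact absurd hu (OnePoint.infty_ne_coe _)
    | coe v =>
      have hv := hw v rfl
      rw [sphereExtend_coe, discToSphere] at hu
      split_ifs at hu with h1
      · have hp : 0 < 1 - ‖h t' v‖ := sub_pos.2 h1
        rw [← OnePoint.coe_injective hu, norm_smul, norm_inv, Real.norm_of_nonneg hp.le,
          inv_mul_eq_div, lt_div_iff₀ hp]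
        by_contra hcon
        have h2 : 1 ≤ (R + 1) * (1 - ‖h t' v‖) := by linarith
        have h3 := hg t' v
        have h4 : ‖v‖ * (1 - ‖h t' v‖) ≤ C := by linarith
        have h5 := mul_le_mul_of_nonneg_left h4 (by linarith : 0 ≤ R + 1)
        have h6 := mul_le_mul_of_nonneg_left h2 (norm_nonneg v)
        linarith
      · exact absurd hu (OnePoint.infty_ne_coe _)
  | coe v =>
    have hemb : IsOpenEmbedding (Prod.map id (↑) : T × V → T × OnePoint V) :=
      IsOpenEmbedding.id.prodMap OnePoint.isOpenEmbedding_coe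
    refine (hemb.continuousAt_iff (x := (t, v))).1 ?_
    exact (continuous_discToSphere.comp hc).continuousAt

/-- The norm on `S^V`, truncated at `10`. -/
def sphereNorm (w : OnePoint V) : ℝ := w.elim 10 fun v => min ‖v‖ 10

theorem continuous_sphereNorm [FiniteDimensional ℝ V] :
    Continuous (sphereNorm : OnePoint V → ℝ) := by
  rw [continuous_iff_continuousAt]
  intro w
  cases w using OnePoint.rec with
  | infty =>
    have : ContinuousAt (fun _ : OnePoint V => (10 : ℝ)) ∞ := continuousAt_const
    refine this.congr ?_
    filter_upwards [eventually_norm_gt_infty (V := V) 10] with w hw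
    cases w using OnePoint.rec with
    | infty => rfl
    | coe v => exact (min_eq_right (hw v rfl).le).symm
  | coe v =>
    rw [OnePoint.continuousAt_coe]
    exact (continuous_norm.min continuous_const).continuousAt

end Sphere

section Smash

theorem smashRel_equivalence {A Y : Type} {a₀ : A} {y₀ : Y} :
    Equivalence (SmashRel A Y a₀ y₀) where
  refl _ := Or.inl rfl
  symm := by
    rintro _ _ (rfl | ⟨h, k⟩)
    exacts [Or.inl rfl, Or.inr ⟨k, h⟩]
  trans := by
    rintro _ _ _ (rfl | ⟨h, k⟩) (rfl | ⟨h', k'⟩)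
    exacts [Or.inl rfl, Or.inr ⟨h', k'⟩, Or.inr ⟨h, k⟩, Or.inr ⟨h, k'⟩]

variable {A Y : Type} [TopologicalSpace A] [TopologicalSpace Y] {a₀ : A} {y₀ : Y}

theorem Smash.mk_left_basepoint (y : Y) : (Smash.mk a₀ y : Smash A Y a₀ y₀) = Smash.pt a₀ y₀ :=
  Quot.sound (Or.inr ⟨Or.inl rfl, Or.inl rfl⟩)

theorem Smash.continuous_mk :
    Continuous fun q : A × Y => (Smash.mk q.1 q.2 : Smash A Y a₀ y₀) :=
  continuous_quot_mk

theorem Smash.mk_eq_mk_iff {a b : A} {x y : Y} :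
    (Smash.mk a x : Smash A Y a₀ y₀) = Smash.mk b y ↔ SmashRel A Y a₀ y₀ (a, x) (b, y) :=
  ⟨fun h => smashRel_equivalence.eqvGen_iff.1 (Quot.eqvGen_exact h), fun h => Quot.sound h⟩

theorem Smash.mk_right_injective {a : A} (ha : a ≠ a₀) :
    Function.Injective fun y : Y => (Smash.mk a y : Smash A Y a₀ y₀) := by
  intro x y h
  rcases Smash.mk_eq_mk_iff.1 h with h | ⟨h, h'⟩
  · exact (Prod.mk.inj h).2
  · exact (h.resolve_left ha).trans (h'.resolve_left ha).symm

theorem Smash.isInducing_mk_right [T1Space A] {a : A} (ha : a ≠ a₀) :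
    IsInducing fun y : Y => (Smash.mk a y : Smash A Y a₀ y₀) := by
  have hc : Continuous fun y : Y => (Smash.mk a y : Smash A Y a₀ y₀) :=
    Smash.continuous_mk.comp (Continuous.prodMk_right _)
  refine ⟨le_antisymm hc.le_induced ?_⟩
  intro U hU
  rw [isOpen_induced_iff]
  by_cases h₀ : y₀ ∈ U
  · refine ⟨{q | Quot.lift (fun q : A × Y => q.1 ≠ a ∨ q.2 ∈ U) ?_ q}, ?_, ?_⟩
    · rintro q q' (h | ⟨h, h'⟩)
      · rw [h]
      · have key : ∀ q : A × Y, (q.1 = a₀ ∨ q.2 = y₀) → (q.1 ≠ a ∨ q.2 ∈ U) := by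
          rintro ⟨b, x⟩ (rfl | rfl)
          exacts [Or.inl ha.symm, Or.inr h₀]
        exact propext ⟨fun _ => key _ h', fun _ => key _ h⟩
    · refine isOpen_coinduced.2 ?_
      exact (isOpen_ne.preimage continuous_fst).union (hU.preimage continuous_snd)
    · ext x
      show (a ≠ a ∨ x ∈ U) ↔ x ∈ U
      simp
  · refine ⟨{q | Quot.lift (fun q : A × Y => q.1 ≠ a₀ ∧ q.2 ∈ U) ?_ q}, ?_, ?_⟩
    · rintro q q' (h | ⟨h, h'⟩)
      · rw [h]
      · have key : ∀ q : A × Y, (q.1 = a₀ ∨ q.2 = y₀) → ¬ (q.1 ≠ a₀ ∧ q.2 ∈ U) := by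
          rintro ⟨b, x⟩ (rfl | rfl) ⟨k, k'⟩
          exacts [k rfl, h₀ k']
        exact propext ⟨fun k => (key _ h k).elim, fun k => (key _ h' k).elim⟩
    · refine isOpen_coinduced.2 ?_
      exact (isOpen_ne.preimage continuous_fst).inter (hU.preimage continuous_snd)
    · ext x
      show (a ≠ a₀ ∧ x ∈ U) ↔ x ∈ U
      simp [ha]

end Smash

section Glue

variable {G V X} {x₀}

theorem exists_label (hVG : ∀ v : V, (∀ g : G, g • v = v) → v = 0)
    (hVlin : ∀ g : G, IsLinearMap ℝ (fun v : V => g • v))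
    {hx : ∀ g : G, g • x₀ = x₀} (f : OmegaV G V X x₀ hx) :
    ∃ p : FixedPts G X, f.1 ((0 : V) : OnePoint V) = Smash.mk ((0 : V) : OnePoint V) (p : X) := by
  have hfix : ∀ g : G, sphereSmashSMul G V X x₀ hx g (f.1 ((0 : V) : OnePoint V)) =
      f.1 ((0 : V) : OnePoint V) := by
    intro g
    rw [← f.2.2 g]
    congr 1
    show (((g • (0 : V) : V)) : OnePoint V) = _
    rw [(hVlin g).map_zero]
  obtain ⟨⟨w, x⟩, hq⟩ := Quot.exists_rep (f.1 ((0 : V) : OnePoint V))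
  change Smash.mk w x = _ at hq
  rw [← hq] at hfix ⊢
  by_cases hb : w = ∞ ∨ x = x₀
  · exact ⟨⟨x₀, hx⟩, Smash.mk_eq_mk_iff.2 (Or.inr ⟨hb, Or.inr rfl⟩)⟩
  · have hs : ∀ g : G, (sphereSMul G V g w, g • x) = (w, x) := by
      intro g
      rcases Smash.mk_eq_mk_iff.1 (hfix g) with h | ⟨-, h⟩
      exacts [h, (hb h).elim]
    push Not at hb
    cases w using OnePoint.rec with
    | infty => exact (hb.1 rfl).elim
    | coe v =>
      have hv : v = 0 := hVG v fun g => OnePoint.coe_injective (Prod.mk.inj (hs g)).1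
      subst hv
      exact ⟨⟨x, fun g => (Prod.mk.inj (hs g)).2⟩, rfl⟩

theorem exists_continuous_label (hVG : ∀ v : V, (∀ g : G, g • v = v) → v = 0)
    (hVlin : ∀ g : G, IsLinearMap ℝ (fun v : V => g • v))
    (hx : ∀ g : G, g • x₀ = x₀) :
    ∃ l : OmegaV G V X x₀ hx → FixedPts G X, Continuous l ∧
      ∀ f, f.1 ((0 : V) : OnePoint V) = Smash.mk ((0 : V) : OnePoint V) (l f : X) := by
  choose l hl using fun f : OmegaV G V X x₀ hx => exists_label hVG hVlin f
  refine ⟨l, ?_, hl⟩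
  refine (((Smash.isInducing_mk_right (y₀ := x₀) (OnePoint.coe_ne_infty (0 : V))).comp
    IsInducing.subtypeVal).continuous_iff).2 ?_
  have : Continuous fun f : OmegaV G V X x₀ hx => f.1 ((0 : V) : OnePoint V) :=
    (continuous_eval_const _).comp continuous_subtype_val
  exact this.congr hl

theorem discToSphere_equivariant (hVlin : ∀ g : G, IsLinearMap ℝ (fun v : V => g • v))
    (hViso : ∀ (g : G) (v : V), ‖g • v‖ = ‖v‖) (g : G) (v : V) :
    discToSphere (g • v) = sphereSMul G V g (discToSphere v) := by
  rw [discToSphere, discToSphere, hViso]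
  split_ifs
  · rw [sphereSMul, OnePoint.map_some, (hVlin g).map_smul]
  · rfl

theorem discToSphereInv_equivariant (hVlin : ∀ g : G, IsLinearMap ℝ (fun v : V => g • v))
    (hViso : ∀ (g : G) (v : V), ‖g • v‖ = ‖v‖) (g : G) (v : V) :
    discToSphereInv (g • v) = sphereSMul G V g (discToSphereInv v) := by
  rw [discToSphereInv, discToSphereInv, ← norm_eq_zero, hViso, norm_eq_zero]
  split_ifs
  · rfl
  · rw [sphereSMul, OnePoint.map_some, (hVlin g).map_smul]

/-- A family of loops glued from discs labelled by `p t` inside the disc of radius `a` and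
radial reparametrizations of `f t` outside of it. -/
theorem exists_glued_loop [FiniteDimensional ℝ V]
    (hVlin : ∀ g : G, IsLinearMap ℝ (fun v : V => g • v))
    (hViso : ∀ (g : G) (v : V), ‖g • v‖ = ‖v‖)
    {hx : ∀ g : G, g • x₀ = x₀} {T : Type} [TopologicalSpace T]
    {a : ℝ} (ha : a < 10) {J : V → OnePoint V} (hJ : Continuous J)
    (hJG : ∀ (g : G) v, J (g • v) = sphereSMul G V g (J v))
    {c : T → ℝ → ℝ} (hc : Continuous fun q : T × ℝ => c q.1 q.2)
    {k : T → ℝ → ℝ} (hk : Continuous fun q : T × ℝ => k q.1 q.2)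
    {C : ℝ} (hg : ∀ t r, 0 ≤ r → r ≤ C + r * (k t r * r))
    {p : T → FixedPts G X} (hp : Continuous p)
    {f : T → OmegaV G V X x₀ hx} (hf : Continuous f)
    (hcompat : ∀ t (v : V), ‖v‖ = a →
      Smash.mk (J (c t ‖v‖ • v)) (p t : X) = (f t).1 (discToSphere (k t ‖v‖ • v))) :
    ∃ Φ : C(T, OmegaV G V X x₀ hx), ∀ t (v : V), (Φ t).1 (v : OnePoint V) =
      if ‖v‖ ≤ a then Smash.mk (J (c t ‖v‖ • v)) (p t : X)
      else (f t).1 (discToSphere (k t ‖v‖ • v)) := by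
  have : ProperSpace V := FiniteDimensional.proper ℝ V
  let inner : T → OnePoint V → OnePoint V :=
    fun t w => w.elim ∞ fun v => J (c t ‖v‖ • v)
  let F : T → OnePoint V → SphereSmash V X x₀ := fun t w =>
    if sphereNorm w ≤ a then Smash.mk (inner t w) (p t : X)
    else (f t).1 (sphereExtend (fun v => k t ‖v‖ • v) w)
  have hnorm : ∀ v : V, sphereNorm (v : OnePoint V) ≤ a ↔ ‖v‖ ≤ a := by
    intro v
    show min ‖v‖ 10 ≤ a ↔ _
    rw [min_le_iff]
    exact or_iff_left (not_le.2 ha)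
  have hFinf : ∀ t, F t ∞ = SphereSmash.pt V X x₀ := by
    intro t
    show (if (10 : ℝ) ≤ a then _ else (f t).1 ∞) = _
    rw [if_neg (not_le.2 ha), (f t).2.1]
  have hFcoe : ∀ t (v : V), F t (v : OnePoint V) =
      if ‖v‖ ≤ a then Smash.mk (J (c t ‖v‖ • v)) (p t : X)
      else (f t).1 (discToSphere (k t ‖v‖ • v)) := by
    intro t v
    by_cases h : ‖v‖ ≤ a
    · exact (if_pos ((hnorm v).2 h)).trans (if_pos h).symm
    · exact (if_neg (mt (hnorm v).1 h)).trans (if_neg h).symm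
  have hin : ContinuousOn (fun q : T × OnePoint V => inner q.1 q.2)
      {q | sphereNorm q.2 ≤ a} := by
    rintro ⟨t, w⟩ hw
    refine ContinuousAt.continuousWithinAt ?_
    cases w using OnePoint.rec with
    | infty => exact (not_le.2 ha hw).elim
    | coe v =>
      have hemb : IsOpenEmbedding (Prod.map id (↑) : T × V → T × OnePoint V) :=
        IsOpenEmbedding.id.prodMap OnePoint.isOpenEmbedding_coe
      refine (hemb.continuousAt_iff (x := (t, v))).1 ?_
      refine (hJ.comp (?_ : Continuous fun q : T × V => c q.1 ‖q.2‖ • q.2)).continuousAt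
      have : Continuous fun q : T × V => c q.1 ‖q.2‖ :=
        hc.comp (continuous_fst.prodMk (continuous_norm.comp continuous_snd))
      exact this.smul continuous_snd
  have hout : Continuous fun q : T × OnePoint V =>
      (f q.1).1 (sphereExtend (fun v => k q.1 ‖v‖ • v) q.2) := by
    have h1 : Continuous fun q : T × OnePoint V => sphereExtend (fun v => k q.1 ‖v‖ • v) q.2 := by
      refine continuous_sphereExtend (h := fun t v => k t ‖v‖ • v) ?_ (C := C) ?_
      · have : Continuous fun q : T × V => k q.1 ‖q.2‖ :=
          hk.comp (continuous_fst.prodMk (continuous_norm.comp continuous_snd))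
        exact this.smul continuous_snd
      · intro t v
        refine (hg t ‖v‖ (norm_nonneg v)).trans ?_
        have : k t ‖v‖ * ‖v‖ ≤ ‖k t ‖v‖ • v‖ := by
          rw [norm_smul]
          exact mul_le_mul_of_nonneg_right (le_abs_self _) (norm_nonneg v)
        have := mul_le_mul_of_nonneg_left this (norm_nonneg v)
        linarith
    have h2 : Continuous fun q : T × OnePoint V => (f q.1).1 :=
      continuous_subtype_val.comp (hf.comp continuous_fst)
    exact h2.eval h1
  have hF : Continuous fun q : T × OnePoint V => F q.1 q.2 := by
    refine continuous_if_le (continuous_sphereNorm.comp continuous_snd) continuous_const ?_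
      hout.continuousOn ?_
    · refine Smash.continuous_mk.comp_continuousOn (hin.prodMk ?_)
      exact (continuous_subtype_val.comp (hp.comp continuous_fst)).continuousOn
    · rintro ⟨t, w⟩ hw
      cases w using OnePoint.rec with
      | infty => exact (ha.ne' hw).elim
      | coe v =>
        refine hcompat t v ?_
        change min ‖v‖ 10 = a at hw
        rcases min_choice ‖v‖ 10 with h | h
        · rw [← hw, h]
        · exact (ha.ne' (h.symm.trans hw)).elim
  have hFG : ∀ t (g : G) w, F t (sphereSMul G V g w) =
      sphereSmashSMul G V X x₀ hx g (F t w) := by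
    intro t g w
    cases w using OnePoint.rec with
    | infty =>
      have e : sphereSMul G V g ∞ = ∞ := rfl
      rw [e, hFinf, ← (f t).2.1, ← (f t).2.2, e]
    | coe v =>
      have e : sphereSMul G V g (v : OnePoint V) = ((g • v : V) : OnePoint V) := rfl
      rw [e, hFcoe, hFcoe, hViso, ← (hVlin g).map_smul, ← (hVlin g).map_smul, hJG,
        discToSphere_equivariant hVlin hViso]
      split_ifs
      · show _ = Smash.mk (sphereSMul G V g _) (g • (p t : X))
        rw [(p t).2 g]
      · exact (f t).2.2 g _
  refine ⟨⟨fun t => ⟨⟨F t, hF.comp (Continuous.prodMk_right t)⟩, hFinf t, hFG t⟩, ?_⟩, hFcoe⟩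
  refine Continuous.subtype_mk ?_ _
  exact ContinuousMap.continuous_of_continuous_uncurry _ hF

end Glue

section Splitting

/-- The factor by which a vector of norm `r` is scaled to lower its norm by `a`, truncating
at `0`. -/
def peelCoeff (a r : ℝ) : ℝ := max 0 (r - a) / max r 1

theorem continuous_peelCoeff (a : ℝ) : Continuous (peelCoeff a) :=
  Continuous.div (by fun_prop) (by fun_prop) fun r => (lt_max_of_lt_right one_pos).ne'

theorem peelCoeff_of_le {a r : ℝ} (h : r ≤ a) : peelCoeff a r = 0 := by
  rw [peelCoeff, max_eq_left (by linarith), zero_div]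

theorem peelCoeff_of_ge {a r : ℝ} (h : a ≤ r) (h1 : 1 ≤ r) : peelCoeff a r = (r - a) / r := by
  rw [peelCoeff, max_eq_right (by linarith), max_eq_left h1]

theorem peelCoeff_growth {a r : ℝ} (ha : 0 ≤ a) (hr : 0 ≤ r) :
    r ≤ (a + 1) + r * (peelCoeff a r * r) := by
  rcases le_total r (a + 1) with h | h
  · have : 0 ≤ peelCoeff a r := div_nonneg (le_max_left _ _) (by positivity)
    have : 0 ≤ r * (peelCoeff a r * r) := by positivity
    linarith
  · rw [peelCoeff_of_ge (by linarith) (by linarith), div_mul_cancel₀ _ (by linarith)]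
    nlinarith

variable {G V X} {x₀}

theorem OmegaV.ext_coe {hx : ∀ g : G, g • x₀ = x₀} {f f' : OmegaV G V X x₀ hx}
    (h : ∀ v : V, f.1 (v : OnePoint V) = f'.1 (v : OnePoint V)) : f = f' := by
  refine Subtype.ext (ContinuousMap.ext fun w => ?_)
  cases w using OnePoint.rec with
  | infty => exact f.2.1.trans f'.2.1.symm
  | coe v => exact h v

theorem OmegaV.vanishes_near_zero_and_infty [FiniteDimensional ℝ V]
    {hx : ∀ g : G, g • x₀ = x₀} (f : OmegaV G V X x₀ hx) {δ R : ℝ} (hδ : 0 < δ)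
    (h₀ : ∀ v : V, ‖v‖ < δ → f.1 (v : OnePoint V) = SphereSmash.pt V X x₀)
    (h₁ : ∀ v : V, R < ‖v‖ → f.1 (v : OnePoint V) = SphereSmash.pt V X x₀) :
    (∃ U ∈ 𝓝 (((0 : V) : OnePoint V)), ∀ w ∈ U, f.1 w = SphereSmash.pt V X x₀) ∧
    (∃ U ∈ 𝓝 ((∞ : OnePoint V)), ∀ w ∈ U, f.1 w = SphereSmash.pt V X x₀) := by
  refine ⟨⟨_, OnePoint.isOpenEmbedding_coe.image_mem_nhds.2 (Metric.ball_mem_nhds (0 : V) hδ), ?_⟩,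
    ⟨_, eventually_norm_gt_infty R, ?_⟩⟩
  · rintro _ ⟨v, hv, rfl⟩
    exact h₀ v (by simpa using hv)
  · intro w hw
    cases w using OnePoint.rec with
    | infty => exact f.2.1
    | coe v => exact h₁ v (hw v rfl)

theorem ZSpace.apply_zero {hx : ∀ g : G, g • x₀ = x₀} (f : ZSpace G V X x₀ hx) :
    f.1.1 ((0 : V) : OnePoint V) = SphereSmash.pt V X x₀ := by
  obtain ⟨U, hU, h⟩ := f.2.1
  exact h _ (mem_of_mem_nhds hU)

theorem vFun_coe {hx : ∀ g : G, g • x₀ = x₀} (p : FixedPts G X) (f : ZSpace G V X x₀ hx)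
    (v : V) : vFun G V X x₀ hx p f (v : OnePoint V) =
      if ‖v‖ < 1 then (Smash.mk (((1 - ‖v‖)⁻¹ • v : V)) (p : X) : SphereSmash V X x₀)
      else f.1.1 ((((‖v‖ - 1) / ‖v‖) • v : V)) := rfl

theorem exists_continuous_vFun [FiniteDimensional ℝ V]
    (hVlin : ∀ g : G, IsLinearMap ℝ (fun v : V => g • v))
    (hViso : ∀ (g : G) (v : V), ‖g • v‖ = ‖v‖) (hx : ∀ g : G, g • x₀ = x₀) :
    ∃ Φ : C(FixedPts G X × ZSpace G V X x₀ hx, OmegaV G V X x₀ hx),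
      ∀ p f w, (Φ (p, f)).1 w = vFun G V X x₀ hx p f w := by
  obtain ⟨Φ, hΦ⟩ := exists_glued_loop (T := FixedPts G X × ZSpace G V X x₀ hx) (hx := hx)
    hVlin hViso (a := 1) (by norm_num) continuous_discToSphere
    (discToSphere_equivariant hVlin hViso)
    (c := fun _ _ => 1) continuous_const
    (k := fun _ r => max 0 (r - 1) / max r 1 ^ 2)
    (Continuous.div (by fun_prop) (by fun_prop) fun q =>
      (pow_pos (lt_max_of_lt_right one_pos) 2).ne')
    (C := 1) (by
      intro _ r hr
      rcases le_total r 1 with h | h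
      · have : 0 ≤ r * (max 0 (r - 1) / max r 1 ^ 2 * r) := by positivity
        linarith
      · rw [max_eq_right (by linarith), max_eq_left h]
        have : r * ((r - 1) / r ^ 2 * r) = r - 1 := by field_simp
        linarith)
    (p := Prod.fst) continuous_fst (f := fun q => q.2.1)
    (continuous_subtype_val.comp continuous_snd) (by
      rintro ⟨p, f⟩ v hv
      simp only [hv, one_smul, sub_self, max_self, zero_div, zero_smul, discToSphere_zero]
      rw [discToSphere_of_one_le hv.ge, Smash.mk_left_basepoint]
      exact f.apply_zero.symm)
  refine ⟨Φ, fun p f w => ?_⟩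
  cases w using OnePoint.rec with
  | infty => exact (Φ (p, f)).2.1
  | coe v =>
    rw [hΦ, vFun_coe]
    rcases lt_trichotomy ‖v‖ 1 with h | h | h
    · rw [if_pos h.le, if_pos h, one_smul, discToSphere_of_lt_one h]
    · rw [if_pos h.le, if_neg h.not_lt, one_smul, discToSphere_of_one_le h.ge,
        Smash.mk_left_basepoint, h, sub_self, zero_div, zero_smul]
      exact f.apply_zero.symm
    · rw [if_neg h.not_ge, if_neg h.not_gt, max_eq_right (by linarith), max_eq_left h.le]
      have hv : 0 < ‖v‖ := by linarith
      have hn : ‖((‖v‖ - 1) / ‖v‖ ^ 2) • v‖ = (‖v‖ - 1) / ‖v‖ := by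
        rw [norm_smul, Real.norm_of_nonneg (div_nonneg (by linarith) (by positivity))]
        field_simp
      rw [discToSphere_of_lt_one (by rw [hn, div_lt_one hv]; linarith), hn, smul_smul]
      congr 3
      field_simp
      ring

theorem exists_residual_loop [FiniteDimensional ℝ V]
    (hVlin : ∀ g : G, IsLinearMap ℝ (fun v : V => g • v))
    (hViso : ∀ (g : G) (v : V), ‖g • v‖ = ‖v‖) {hx : ∀ g : G, g • x₀ = x₀}
    {l : OmegaV G V X x₀ hx → FixedPts G X} (hlc : Continuous l)
    (hl : ∀ f, f.1 ((0 : V) : OnePoint V) = Smash.mk ((0 : V) : OnePoint V) (l f : X)) :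
    ∃ Φ : C(OmegaV G V X x₀ hx, ZSpace G V X x₀ hx), ∀ f (v : V), (Φ f).1.1 (v : OnePoint V) =
      if ‖v‖ ≤ 2 then Smash.mk (discToSphereInv (peelCoeff 1 ‖v‖ • v)) (l f : X)
      else f.1 (discToSphere (peelCoeff 2 ‖v‖ • v)) := by
  obtain ⟨Φ, hΦ⟩ := exists_glued_loop (T := OmegaV G V X x₀ hx) (hx := hx)
    hVlin hViso (a := 2) (by norm_num) continuous_discToSphereInv
    (discToSphereInv_equivariant hVlin hViso)
    (c := fun _ => peelCoeff 1) ((continuous_peelCoeff 1).comp continuous_snd)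
    (k := fun _ => peelCoeff 2) ((continuous_peelCoeff 2).comp continuous_snd)
    (C := 2 + 1) (fun _ r hr => peelCoeff_growth (by norm_num) hr)
    (p := l) hlc (f := id) continuous_id (by
      intro f v hv
      rw [hv, peelCoeff_of_le le_rfl, peelCoeff_of_ge (by norm_num) (by norm_num), zero_smul,
        discToSphere_zero, discToSphereInv_of_norm_eq_one]
      · exact (hl f).symm
      · rw [norm_smul, hv]; norm_num)
  refine ⟨⟨fun f => ⟨Φ f, (Φ f).vanishes_near_zero_and_infty (δ := 1) (R := 3) one_pos
    (fun v hv => ?_) (fun v hv => ?_)⟩, Φ.continuous.subtype_mk _⟩, hΦ⟩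
  · rw [hΦ, if_pos (by linarith), peelCoeff_of_le hv.le, zero_smul, discToSphereInv_zero,
      Smash.mk_left_basepoint]
    rfl
  · rw [hΦ, if_neg (by linarith), peelCoeff_of_ge (by linarith) (by linarith),
      discToSphere_of_one_le, id, f.2.1]
    rw [norm_smul, Real.norm_of_nonneg (div_nonneg (by linarith) (by linarith)),
      div_mul_cancel₀ _ (by linarith)]
    linarith

theorem exists_reparametrization_homotopy [FiniteDimensional ℝ V]
    (hVlin : ∀ g : G, IsLinearMap ℝ (fun v : V => g • v))
    (hViso : ∀ (g : G) (v : V), ‖g • v‖ = ‖v‖) (hx : ∀ g : G, g • x₀ = x₀)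
    {κ : ℝ → ℝ} (hκ : Continuous κ) {C : ℝ} (hC : 0 ≤ C)
    (hg : ∀ r, 0 ≤ r → r ≤ C + r * (κ r * r)) :
    ∃ K : C(OmegaV G V X x₀ hx × I, OmegaV G V X x₀ hx),
      (∀ f (v : V), (K (f, 0)).1 (v : OnePoint V) = f.1 (discToSphere (κ ‖v‖ • v))) ∧
      (∀ f, K (f, 1) = f) ∧
      ∀ f t, ∃ F : C(OnePoint V, OnePoint V), F ((0 : V) : OnePoint V) = ((0 : V) : OnePoint V) ∧
        F ∞ = ∞ ∧ ∀ w, (K (f, t)).1 w = f.1 (F w) := by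
  let k : OmegaV G V X x₀ hx × I → ℝ → ℝ := fun q r =>
    (1 - (q.2 : ℝ)) * κ r + (q.2 : ℝ) * (1 + |r|)⁻¹
  have hk : Continuous fun q : (OmegaV G V X x₀ hx × I) × ℝ => k q.1 q.2 := by
    have h1 : Continuous fun q : (OmegaV G V X x₀ hx × I) × ℝ => (1 + |q.2|)⁻¹ :=
      Continuous.inv₀ (by fun_prop) fun q => by positivity
    have h2 : Continuous fun q : (OmegaV G V X x₀ hx × I) × ℝ => (q.1.2 : ℝ) :=
      continuous_subtype_val.comp (continuous_snd.comp continuous_fst)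
    exact ((continuous_const.sub h2).mul (hκ.comp continuous_snd)).add (h2.mul h1)
  have hkg : ∀ q r, 0 ≤ r → r ≤ (C + 1) + r * (k q r * r) := by
    rintro ⟨f, t⟩ r hr
    have h0 : 0 ≤ (t : ℝ) := t.2.1
    have h1 : 0 ≤ 1 - (t : ℝ) := sub_nonneg.2 t.2.2
    have e : r * ((1 + r)⁻¹ * r) = r - 1 + (1 + r)⁻¹ := by field_simp; ring
    have e1 : 0 ≤ (1 + r)⁻¹ := by positivity
    have e2 := mul_le_mul_of_nonneg_left (hg r hr) h1
    have e3 : (t : ℝ) * (r - 1) ≤ t * (r * ((1 + r)⁻¹ * r)) :=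
      mul_le_mul_of_nonneg_left (by linarith) h0
    have e4 : r * (k (f, t) r * r) =
        (1 - (t : ℝ)) * (r * (κ r * r)) + t * (r * ((1 + r)⁻¹ * r)) := by
      simp only [k, abs_of_nonneg hr]; ring
    nlinarith
  obtain ⟨K, hK⟩ := exists_glued_loop (hx := hx)
    hVlin hViso (a := -1) (by norm_num) continuous_discToSphere
    (discToSphere_equivariant hVlin hViso)
    (c := fun _ _ => 0) continuous_const hk hkg
    (p := fun _ => ⟨x₀, hx⟩) continuous_const (f := Prod.fst) continuous_fst
    (fun _ v hv => absurd (norm_nonneg v) (by rw [hv]; norm_num))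
  have hK' : ∀ q (v : V), (K q).1 (v : OnePoint V) = q.1.1 (discToSphere (k q ‖v‖ • v)) :=
    fun q v => (hK q v).trans (if_neg (by have := norm_nonneg v; linarith))
  refine ⟨K, fun f v => ?_, fun f => OmegaV.ext_coe fun v => ?_, fun f t => ?_⟩
  · rw [hK']
    simp [k]
  · rw [hK']
    have e : k (f, 1) ‖v‖ = (1 + ‖v‖)⁻¹ := by simp [k]
    have hn : ‖(1 + ‖v‖)⁻¹ • v‖ = ‖v‖ / (1 + ‖v‖) := by
      rw [norm_smul, Real.norm_of_nonneg (by positivity), inv_mul_eq_div]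
    rw [e, discToSphere_of_lt_one (by rw [hn, div_lt_one (by positivity)]; linarith), hn,
      smul_smul]
    have : (1 - ‖v‖ / (1 + ‖v‖))⁻¹ * (1 + ‖v‖)⁻¹ = 1 := by
      have : 0 < 1 + ‖v‖ := by positivity
      field_simp
      simp
    rw [this, one_smul]
  · have hF : Continuous (sphereExtend fun v : V => k (f, t) ‖v‖ • v) := by
      refine (continuous_sphereExtend (T := OmegaV G V X x₀ hx × I) (C := C + 1)
        (h := fun q v => k q ‖v‖ • v) ?_ ?_).comp
        (Continuous.prodMk_right (f, t))
      · exact (hk.comp (continuous_fst.prodMk (continuous_norm.comp continuous_snd))).smul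
          continuous_snd
      · intro q v
        refine (hkg q ‖v‖ (norm_nonneg v)).trans ?_
        rw [norm_smul]
        gcongr
        exact le_abs_self _
    refine ⟨⟨_, hF⟩, ?_, rfl, fun w => ?_⟩
    · show sphereExtend (fun v : V => k (f, t) ‖v‖ • v) ((0 : V) : OnePoint V) = ((0 : V) : OnePoint V)
      rw [sphereExtend_coe, smul_zero, discToSphere_zero]
    · cases w using OnePoint.rec with
      | infty => exact (K (f, t)).2.1.trans f.2.1.symm
      | coe v => exact hK' (f, t) v

theorem exists_reparametrization_homotopy_null [FiniteDimensional ℝ V]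
    (hVlin : ∀ g : G, IsLinearMap ℝ (fun v : V => g • v))
    (hViso : ∀ (g : G) (v : V), ‖g • v‖ = ‖v‖) (hx : ∀ g : G, g • x₀ = x₀)
    {κ : ℝ → ℝ} (hκ : Continuous κ) {C : ℝ} (hC : 0 ≤ C)
    (hg : ∀ r, 0 ≤ r → r ≤ C + r * (κ r * r)) :
    ∃ K : C(ZSpace G V X x₀ hx × I, ZSpace G V X x₀ hx),
      (∀ f (v : V), (K (f, 0)).1.1 (v : OnePoint V) = f.1.1 (discToSphere (κ ‖v‖ • v))) ∧
      (∀ f, K (f, 1) = f) := by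
  obtain ⟨K, hK₀, hK₁, hK⟩ := exists_reparametrization_homotopy hVlin hViso hx hκ hC hg
  refine ⟨⟨fun q => ⟨K (q.1.1, q.2), ?_⟩, ?_⟩, fun f v => hK₀ f.1 v,
    fun f => Subtype.ext (hK₁ f.1)⟩
  · obtain ⟨F, h0, hi, hF⟩ := hK q.1.1 q.2
    obtain ⟨⟨U, hU, hU'⟩, W, hW, hW'⟩ := q.1.2
    refine ⟨⟨F ⁻¹' U, F.continuous.continuousAt (by rwa [h0]), fun w hw => ?_⟩,
      ⟨F ⁻¹' W, F.continuous.continuousAt (by rwa [hi]), fun w hw => ?_⟩⟩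
    · rw [hF]; exact hU' _ hw
    · rw [hF]; exact hW' _ hw
  · refine Continuous.subtype_mk ?_ _
    exact K.continuous.comp
      ((continuous_subtype_val.comp continuous_fst).prodMk continuous_snd)

theorem homotopic_of_continuousMap_prod {A B : Type*} [TopologicalSpace A] [TopologicalSpace B]
    {f g : C(A, B)} (H : C(A × I, B)) (h0 : ∀ a, H (a, 0) = f a) (h1 : ∀ a, H (a, 1) = g a) :
    ContinuousMap.Homotopic f g :=
  ⟨{ toContinuousMap := H.comp (ContinuousMap.prodSwap), map_zero_left := h0, map_one_left := h1 }⟩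

theorem vFun_residual_homotopic_id [FiniteDimensional ℝ V]
    (hVlin : ∀ g : G, IsLinearMap ℝ (fun v : V => g • v))
    (hViso : ∀ (g : G) (v : V), ‖g • v‖ = ‖v‖) {hx : ∀ g : G, g • x₀ = x₀}
    {l : C(OmegaV G V X x₀ hx, FixedPts G X)}
    (hl : ∀ f, f.1 ((0 : V) : OnePoint V) = Smash.mk ((0 : V) : OnePoint V) (l f : X))
    {Φ : C(FixedPts G X × ZSpace G V X x₀ hx, OmegaV G V X x₀ hx)}
    (hΦ : ∀ p f w, (Φ (p, f)).1 w = vFun G V X x₀ hx p f w)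
    {Ψ : C(OmegaV G V X x₀ hx, ZSpace G V X x₀ hx)}
    (hΨ : ∀ f (v : V), (Ψ f).1.1 (v : OnePoint V) =
      if ‖v‖ ≤ 2 then Smash.mk (discToSphereInv (peelCoeff 1 ‖v‖ • v)) (l f : X)
      else f.1 (discToSphere (peelCoeff 2 ‖v‖ • v))) :
    (Φ.comp (l.prodMk Ψ)).Homotopic (ContinuousMap.id _) := by
  obtain ⟨K, hK⟩ := exists_glued_loop (T := OmegaV G V X x₀ hx × I) (hx := hx)
    hVlin hViso (a := 3) (by norm_num) continuous_discToSphere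
    (discToSphere_equivariant hVlin hViso)
    (c := fun q r => (1 - (q.2 : ℝ)) * min 1 ((3 - r) / max r 1))
    (by
      have h2 : Continuous fun q : (OmegaV G V X x₀ hx × I) × ℝ => (q.1.2 : ℝ) :=
        continuous_subtype_val.comp (continuous_snd.comp continuous_fst)
      exact (continuous_const.sub h2).mul (continuous_const.min (Continuous.div (by fun_prop)
        (by fun_prop) fun q => (lt_max_of_lt_right one_pos).ne')))
    (k := fun _ => peelCoeff 3) ((continuous_peelCoeff 3).comp continuous_snd)
    (C := 3 + 1) (fun _ r hr => peelCoeff_growth (by norm_num) hr)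
    (p := fun q => l q.1) (l.continuous.comp continuous_fst) (f := Prod.fst) continuous_fst (by
      rintro ⟨f, t⟩ v hv
      simp only [hv, peelCoeff_of_le le_rfl, sub_self, zero_div]
      norm_num [discToSphere_zero]
      exact (hl f).symm)
  obtain ⟨K', hK₀, hK₁, -⟩ := exists_reparametrization_homotopy hVlin hViso hx
    (continuous_peelCoeff 3) (C := 3 + 1) (by norm_num)
    (fun r hr => peelCoeff_growth (by norm_num) hr)
  refine (homotopic_of_continuousMap_prod (g := ⟨fun f => K (f, 1), by fun_prop⟩) K
    (fun f => ?_) fun _ => rfl).trans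
    (homotopic_of_continuousMap_prod K' (fun f => ?_) hK₁)
  · refine OmegaV.ext_coe fun v => ?_
    show _ = (Φ (l f, Ψ f)).1 _
    rw [hΦ, vFun_coe, hK]
    simp only [Set.Icc.coe_zero, sub_zero, one_mul]
    rcases lt_or_ge ‖v‖ 1 with h | h
    · rw [if_pos (by linarith), if_pos h, max_eq_right h.le, min_eq_left (by linarith), one_smul,
        discToSphere_of_lt_one h]
    have hv : 0 < ‖v‖ := by linarith
    have hv0 : v ≠ 0 := norm_pos_iff.1 hv
    have hn : ‖((‖v‖ - 1) / ‖v‖) • v‖ = ‖v‖ - 1 := by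
      rw [norm_smul, Real.norm_of_nonneg (div_nonneg (by linarith) hv.le),
        div_mul_cancel₀ _ hv.ne']
    rw [if_neg h.not_gt, hΨ, hn, max_eq_left h, smul_smul, smul_smul]
    rcases le_or_gt ‖v‖ 2 with h2 | h2
    · rw [if_pos (by linarith), if_pos (by linarith), peelCoeff_of_le (by linarith), zero_mul,
        zero_smul, discToSphereInv_zero, discToSphere_of_one_le]
      have : 1 / ‖v‖ ≤ min 1 ((3 - ‖v‖) / ‖v‖) :=
        le_min ((div_le_one hv).2 h) (by gcongr; linarith)
      rw [norm_smul]
      calc 1 = 1 / ‖v‖ * ‖v‖ := by field_simp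
        _ ≤ _ := by gcongr; exact this.trans (le_abs_self _)
    rcases le_or_gt ‖v‖ 3 with h3 | h3
    · rw [if_pos h3, if_pos (by linarith), peelCoeff_of_ge (by linarith) (by linarith),
        min_eq_right ((div_le_one hv).2 (by linarith))]
      have e : (‖v‖ - 1 - 1) / (‖v‖ - 1) * ((‖v‖ - 1) / ‖v‖) = (‖v‖ - 2) / ‖v‖ := by
        have : ‖v‖ - 1 ≠ 0 := by linarith
        field_simp
        ring
      rw [e, discToSphereInv_smul hv0 (by linarith) (by linarith)]
      congr 4
      ring
    · rw [if_neg h3.not_ge, if_neg (by linarith), peelCoeff_of_ge h3.le (by linarith),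
        peelCoeff_of_ge (by linarith) (by linarith)]
      congr 3
      have : ‖v‖ - 1 ≠ 0 := by linarith
      field_simp
      ring
  · refine OmegaV.ext_coe fun v => ?_
    show _ = (K (f, 1)).1 _
    rw [hK₀, hK]
    split_ifs with h
    · rw [peelCoeff_of_le h, zero_smul, discToSphere_zero, hl]
      simp [discToSphere_zero]
    · rfl

theorem residual_vFun_homotopic_id [FiniteDimensional ℝ V]
    (hVlin : ∀ g : G, IsLinearMap ℝ (fun v : V => g • v))
    (hViso : ∀ (g : G) (v : V), ‖g • v‖ = ‖v‖) {hx : ∀ g : G, g • x₀ = x₀}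
    {l : C(OmegaV G V X x₀ hx, FixedPts G X)}
    (hl : ∀ f, f.1 ((0 : V) : OnePoint V) = Smash.mk ((0 : V) : OnePoint V) (l f : X))
    {Φ : C(FixedPts G X × ZSpace G V X x₀ hx, OmegaV G V X x₀ hx)}
    (hΦ : ∀ p f w, (Φ (p, f)).1 w = vFun G V X x₀ hx p f w)
    {Ψ : C(OmegaV G V X x₀ hx, ZSpace G V X x₀ hx)}
    (hΨ : ∀ f (v : V), (Ψ f).1.1 (v : OnePoint V) =
      if ‖v‖ ≤ 2 then Smash.mk (discToSphereInv (peelCoeff 1 ‖v‖ • v)) (l f : X)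
      else f.1 (discToSphere (peelCoeff 2 ‖v‖ • v))) :
    ((l.prodMk Ψ).comp Φ).Homotopic (ContinuousMap.id _) := by
  let κ : ℝ → ℝ := fun r => max 0 (2 * r - 5) / max (r - 2) (1 / 2) / max r 1
  have hpos : ∀ r : ℝ, 0 < max (r - 2) (1 / 2) := fun r => lt_max_of_lt_right (by norm_num)
  have hpos' : ∀ r : ℝ, 0 < max (3 - r) (1 / 2) := fun r => lt_max_of_lt_right (by norm_num)
  have hpos1 : ∀ r : ℝ, 0 < max r 1 := fun r => lt_max_of_lt_right one_pos
  have hκ : Continuous κ :=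
    Continuous.div (Continuous.div (by fun_prop) (by fun_prop) fun r => (hpos r).ne')
      (by fun_prop) fun r => (hpos1 r).ne'
  have hκ₀ : ∀ r, r ≤ 5 / 2 → κ r = 0 := fun r hr => by
    simp only [κ]
    rw [max_eq_left (by linarith), zero_div, zero_div]
  have hκ₁ : ∀ r, 5 / 2 ≤ r → κ r = (2 * r - 5) / (r - 2) / r := fun r hr => by
    simp only [κ]
    rw [max_eq_right (by linarith), max_eq_left (by linarith), max_eq_left (by linarith)]
  have hg : ∀ r, 0 ≤ r → r ≤ 3 + r * (κ r * r) := by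
    intro r hr
    rcases le_total r 3 with h | h
    · have : 0 ≤ κ r := div_nonneg (div_nonneg (le_max_left _ _) (hpos r).le) (hpos1 r).le
      have : 0 ≤ r * (κ r * r) := by positivity
      linarith
    · rw [hκ₁ r (by linarith), div_mul_cancel₀ _ (by linarith)]
      have : 1 ≤ (2 * r - 5) / (r - 2) := by rw [le_div_iff₀ (by linarith)]; linarith
      nlinarith
  let c : ℝ → ℝ := fun r => min (max 0 (r - 1)) ((5 - 2 * r) / max (3 - r) (1 / 2)) / max r 1
  have hc : Continuous c :=
    Continuous.div (Continuous.min (by fun_prop)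
      (Continuous.div (by fun_prop) (by fun_prop) fun r => (hpos' r).ne'))
      (by fun_prop) fun r => (hpos1 r).ne'
  have hc₁ : ∀ r, r ≤ 2 → c r = peelCoeff 1 r := by
    intro r hr
    simp only [c, peelCoeff]
    rw [min_eq_left]
    rw [max_eq_left (by linarith : (1 / 2 : ℝ) ≤ 3 - r), le_div_iff₀ (by linarith)]
    rcases le_total r 1 with h | h
    · rw [max_eq_left (by linarith)]; linarith
    · rw [max_eq_right (by linarith)]; nlinarith
  have hc₂ : ∀ r, 2 ≤ r → r ≤ 5 / 2 → c r = (5 - 2 * r) / (3 - r) / r := by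
    intro r hr hr'
    simp only [c]
    rw [max_eq_left (by linarith : (1 / 2 : ℝ) ≤ 3 - r), max_eq_left (by linarith : 1 ≤ r),
      max_eq_right (by linarith : 0 ≤ r - 1), min_eq_right]
    rw [div_le_iff₀ (by linarith)]
    nlinarith
  obtain ⟨H, hH⟩ := exists_glued_loop (T := (FixedPts G X × ZSpace G V X x₀ hx) × I) (hx := hx)
    hVlin hViso (a := 5 / 2) (by norm_num) continuous_discToSphereInv
    (discToSphereInv_equivariant hVlin hViso)
    (c := fun q r => (1 - (q.2 : ℝ)) * c r)
    (by
      have h2 : Continuous fun q : ((FixedPts G X × ZSpace G V X x₀ hx) × I) × ℝ =>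
          (q.1.2 : ℝ) := continuous_subtype_val.comp (continuous_snd.comp continuous_fst)
      exact (continuous_const.sub h2).mul (hc.comp continuous_snd))
    (k := fun _ => κ) (hκ.comp continuous_snd)
    (C := 3) (fun _ r hr => hg r hr)
    (p := fun q => q.1.1) (continuous_fst.comp continuous_fst)
    (f := fun q => q.1.2.1)
    (continuous_subtype_val.comp (continuous_snd.comp continuous_fst)) (by
      rintro ⟨⟨p, f⟩, t⟩ v hv
      rw [hv, hκ₀ _ le_rfl, hc₂ _ (by norm_num) le_rfl]
      norm_num [discToSphere_zero, discToSphereInv_zero]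
      rw [Smash.mk_left_basepoint]
      exact f.apply_zero.symm)
  have hHnull : ∀ q, _ := fun q => (H q).vanishes_near_zero_and_infty (δ := 1) (R := 3) one_pos
    (fun v hv => by
      rw [hH, if_pos (by linarith), hc₁ _ (by linarith), peelCoeff_of_le hv.le, mul_zero,
        zero_smul, discToSphereInv_zero, Smash.mk_left_basepoint]
      rfl)
    (fun v hv => by
      rw [hH, if_neg (by linarith), hκ₁ _ (by linarith), discToSphere_of_one_le, q.1.2.1.2.1]
      have : 1 ≤ (2 * ‖v‖ - 5) / (‖v‖ - 2) := by rw [le_div_iff₀ (by linarith)]; linarith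
      rw [norm_smul, Real.norm_of_nonneg (div_nonneg (by linarith) (by linarith)),
        div_mul_cancel₀ _ (by linarith)]
      exact this)
  let HZ : C((FixedPts G X × ZSpace G V X x₀ hx) × I, ZSpace G V X x₀ hx) :=
    ⟨fun q => ⟨H q, hHnull q⟩, H.continuous.subtype_mk _⟩
  obtain ⟨K, hK₀, hK₁⟩ :=
    exists_reparametrization_homotopy_null hVlin hViso hx hκ (C := 3) (by norm_num) hg
  have hlabel : ∀ p f, l (Φ (p, f)) = p := by
    intro p f
    refine Subtype.ext (Smash.mk_right_injective (y₀ := x₀) (OnePoint.coe_ne_infty (0 : V)) ?_)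
    show Smash.mk _ (l (Φ (p, f)) : X) = Smash.mk _ (p : X)
    rw [← hl, hΦ, vFun_coe]
    simp
  have hfst : Continuous fun q : (FixedPts G X × ZSpace G V X x₀ hx) × I => q.1.1 := by fun_prop
  refine (homotopic_of_continuousMap_prod
    (g := ⟨fun q => (q.1, HZ (q, 1)), by fun_prop⟩)
    ⟨fun q => (q.1.1, HZ q), hfst.prodMk HZ.continuous⟩ ?_ fun _ => rfl).trans
    (homotopic_of_continuousMap_prod
      ⟨fun q => (q.1.1, K (q.1.2, q.2)), hfst.prodMk (by fun_prop)⟩ ?_ ?_)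
  · rintro ⟨p, f⟩
    refine Prod.ext ?_ (Subtype.ext (OmegaV.ext_coe fun v => ?_))
    · exact (hlabel p f).symm
    · show (H ((p, f), 0)).1 _ = (Ψ (Φ (p, f))).1.1 _
      rw [hH, hΨ]
      simp only [Set.Icc.coe_zero, sub_zero, one_mul]
      rcases le_or_gt ‖v‖ 2 with h2 | h2
      · have hlp : l (Φ (p, f)) = p := hlabel p f
        rw [if_pos h2, if_pos (by linarith), hc₁ _ h2, hlp]
      have hv : 0 < ‖v‖ := by linarith
      have hv0 : v ≠ 0 := norm_pos_iff.1 hv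
      have hn : ‖((‖v‖ - 2) / ‖v‖) • v‖ = ‖v‖ - 2 := by
        rw [norm_smul, Real.norm_of_nonneg (div_nonneg (by linarith) hv.le),
          div_mul_cancel₀ _ hv.ne']
      have hn' : 5 / 2 ≤ ‖v‖ →
          ‖((2 * ‖v‖ - 5) / (‖v‖ - 2) / ‖v‖) • v‖ = (2 * ‖v‖ - 5) / (‖v‖ - 2) := by
        intro h
        rw [norm_smul, Real.norm_of_nonneg (div_nonneg (div_nonneg (by linarith)
          (by linarith)) hv.le), div_mul_cancel₀ _ hv.ne']
      rw [if_neg h2.not_ge, peelCoeff_of_ge h2.le (by linarith)]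
      rcases le_or_gt 3 ‖v‖ with h3 | h3
      · rw [if_neg (by linarith), hκ₁ _ (by linarith), discToSphere_of_one_le,
          discToSphere_of_one_le (by rw [hn]; linarith), f.1.2.1, (Φ (p, f)).2.1]
        rw [hn' (by linarith), le_div_iff₀ (by linarith)]
        linarith
      have hs : 0 < 3 - ‖v‖ := by linarith
      have hsne : 3 - ‖v‖ ≠ 0 := hs.ne'
      have hs2 : ‖v‖ - 2 ≠ 0 := by linarith
      have hm : ‖((‖v‖ - 2) / (3 - ‖v‖) / ‖v‖) • v‖ = (‖v‖ - 2) / (3 - ‖v‖) := by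
        rw [norm_smul, Real.norm_of_nonneg (div_nonneg (div_nonneg (by linarith) hs.le) hv.le),
          div_mul_cancel₀ _ hv.ne']
      have hd : discToSphere (((‖v‖ - 2) / ‖v‖) • v) =
          ((((‖v‖ - 2) / (3 - ‖v‖) / ‖v‖) • v : V) : OnePoint V) := by
        rw [discToSphere_of_lt_one (by rw [hn]; linarith), hn, smul_smul,
          show 1 - (‖v‖ - 2) = 3 - ‖v‖ by ring]
        congr 2
        field_simp
      rw [hd, hΦ, vFun_coe, hm]
      rcases lt_trichotomy ‖v‖ (5 / 2) with h | h | h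
      · have hlt : (‖v‖ - 2) / (3 - ‖v‖) < 1 := by rw [div_lt_one hs]; linarith
        rw [if_pos h.le, if_pos hlt, hc₂ _ h2.le h.le,
          discToSphereInv_smul hv0 (div_nonneg (by linarith) hs.le)
            (by rw [div_le_one hs]; linarith)]
        have e : 1 - (5 - 2 * ‖v‖) / (3 - ‖v‖) = (‖v‖ - 2) / (3 - ‖v‖) := by
          field_simp
          ring
        rw [e, discToSphere_of_lt_one (by rw [hm]; exact hlt), hm]
      · rw [if_pos h.le, if_neg (by rw [h]; norm_num), hc₂ _ h2.le h.le, h]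
        norm_num [discToSphereInv_zero, f.apply_zero, Smash.mk_left_basepoint, SphereSmash.pt]
      · have hge : ¬ (‖v‖ - 2) / (3 - ‖v‖) < 1 := by rw [div_lt_one hs]; linarith
        rw [if_neg h.not_ge, if_neg hge, hκ₁ _ h.le, discToSphere_of_lt_one, hn' h.le,
          smul_smul, smul_smul]
        · congr 3
          have e : 1 - (2 * ‖v‖ - 5) / (‖v‖ - 2) = (3 - ‖v‖) / (‖v‖ - 2) := by
            field_simp
            ring
          rw [e]
          field_simp
          ring
        · rw [hn' h.le, div_lt_one (by linarith)]
          linarith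
  · rintro ⟨p, f⟩
    refine Prod.ext rfl (Subtype.ext (OmegaV.ext_coe fun v => ?_))
    show (K (f, 0)).1.1 _ = (H ((p, f), 1)).1 _
    rw [hK₀, hH]
    split_ifs with h
    · rw [hκ₀ _ h, zero_smul, discToSphere_zero, f.apply_zero]
      simp [discToSphereInv_zero, Smash.mk_left_basepoint, SphereSmash.pt]
    · rfl
  · rintro ⟨p, f⟩
    exact Prod.ext rfl (hK₁ f)

end Splitting

/-- **Rourke–Sanderson**, section 4: `u` and `v` are mutually inverse homotopy
equivalences between `Ω^V S^V(X)` and `X^G × Z`. -/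
theorem loops_split_off_fixed_labels
    (G : Type) [Group G] [Finite G]
    (V : Type) [NormedAddCommGroup V] [InnerProductSpace ℝ V] [FiniteDimensional ℝ V]
    [MulAction G V]
    (hVlin : ∀ g : G, IsLinearMap ℝ (fun v : V => g • v))
    (hViso : ∀ (g : G) (v : V), ‖g • v‖ = ‖v‖)
    (hVG : ∀ v : V, (∀ g : G, g • v = v) → v = 0)
    (X : Type) [TopologicalSpace X] [MulAction G X]
    (hXcont : ∀ g : G, Continuous (fun x : X => g • x))
    (x₀ : X) (hx : ∀ g : G, g • x₀ = x₀)
    (hnondeg : ∃ r : C(X × I, X × I),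
      (∀ (g : G) (q : X × I), r (g • q.1, q.2) = (g • (r q).1, (r q).2)) ∧
      (∀ q : X × I, (r q).2 = 0 ∨ (r q).1 = x₀) ∧
      (∀ q : X × I, (q.2 = 0 ∨ q.1 = x₀) → r q = q)) :
    ∃ v' : FixedPts G X × ZSpace G V X x₀ hx → OmegaV G V X x₀ hx,
      -- `v` is given by the formula above
      (∀ (p : FixedPts G X) (f : ZSpace G V X x₀ hx) (w : OnePoint V),
        (v' (p, f)).1 w = vFun G V X x₀ hx p f w) ∧
      ∃ u : OmegaV G V X x₀ hx → FixedPts G X × ZSpace G V X x₀ hx,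
        Continuous v' ∧ Continuous u ∧
        -- `u` records the `G`-fixed label determined by the value at `0 ∈ S^V`
        (∀ f : OmegaV G V X x₀ hx,
          f.1 (((0 : V) : OnePoint V)) =
            Quot.mk _ ((((0 : V) : OnePoint V)), ((u f).1 : X))) ∧
        -- `u` and `v` are mutually inverse homotopy equivalences
        (∃ H : (FixedPts G X × ZSpace G V X x₀ hx) × I →
            FixedPts G X × ZSpace G V X x₀ hx,
          Continuous H ∧ (∀ a, H (a, 0) = u (v' a)) ∧ (∀ a, H (a, 1) = a)) ∧
        (∃ K : OmegaV G V X x₀ hx × I → OmegaV G V X x₀ hx,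
          Continuous K ∧ (∀ f, K (f, 0) = v' (u f)) ∧ (∀ f, K (f, 1) = f)) := by
  obtain ⟨l, hlc, hl⟩ := exists_continuous_label hVG hVlin hx
  obtain ⟨Φ, hΦ⟩ := exists_continuous_vFun (X := X) hVlin hViso hx
  obtain ⟨Ψ, hΨ⟩ := exists_residual_loop hVlin hViso hlc hl
  let L : C(OmegaV G V X x₀ hx, FixedPts G X) := ⟨l, hlc⟩
  obtain ⟨H⟩ := residual_vFun_homotopic_id (l := L) hVlin hViso hl hΦ hΨ
  obtain ⟨K⟩ := vFun_residual_homotopic_id (l := L) hVlin hViso hl hΦ hΨ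
  exact ⟨Φ, hΦ, L.prodMk Ψ, Φ.continuous, (L.prodMk Ψ).continuous, hl,
    ⟨fun q => H (q.2, q.1), H.continuous.comp (continuous_snd.prodMk continuous_fst),
      fun a => H.apply_zero a, fun a => H.apply_one a⟩,
    ⟨fun q => K (q.2, q.1), K.continuous.comp (continuous_snd.prodMk continuous_fst),
      fun f => K.apply_zero f, fun f => K.apply_one f⟩⟩

end
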